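/- Let H_1,…,H_k be half-spaces of ℝⁿ, where H_i = {x : h_{i,1}x_1 + … + h_{i,n}x_n > c_i}, let ω_1,…,ω_p be a partition of ℝⁿ such that each ω_j equals the intersection of the half-spaces H_i with i in some index set S_j ⊆ {1,…,k} together with the complements of the remaining half-spaces, and let f : ℝⁿ → ℝᵐ be a function that agrees with an affine map x ↦ α_j x + β_j on each part ω_j. Then there exists a shallow network S with 3 hidden layers over the extended reals, with hidden layer widths 2n + k, 2n + p, and 2·p·m respectively, such that S(x) = f(x) for all x ∈ ℝⁿ. In particular the width of S is bounded by max{2n + k, 2n + p, 2·p·m}. -/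

import Mathlib

open scoped BigOperators

/-- Matrix-vector multiplication over the extended reals, where `(±∞) * 0 = 0`
by the convention built into `EReal` multiplication. -/
noncomputable def emulVec {a c : ℕ} (M : Matrix (Fin a) (Fin c) EReal)
    (x : Fin c → EReal) : Fin a → EReal :=
  fun i => ∑ j, M i j * x j

/-- ReLU on the extended reals: `erelu ⊥ = 0` and `erelu ⊤ = ⊤`. -/
noncomputable def erelu (t : EReal) : EReal := max 0 t

/-- A shallow network with exactly three hidden layers (of widths `k₁, k₂, k₃`) over the
extended reals. -/
noncomputable def shallow (n m k₁ k₂ k₃ : ℕ)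
    (W1 : Matrix (Fin k₁) (Fin n) EReal) (b1 : Fin k₁ → EReal)
    (W2 : Matrix (Fin k₂) (Fin k₁) EReal) (b2 : Fin k₂ → EReal)
    (W3 : Matrix (Fin k₃) (Fin k₂) EReal) (b3 : Fin k₃ → EReal)
    (W4 : Matrix (Fin m) (Fin k₃) EReal) (b4 : Fin m → EReal)
    (x : Fin n → ℝ) : Fin m → EReal :=
  let χ1 : Fin k₁ → EReal := fun i => erelu (emulVec W1 (fun j => (x j : EReal)) i + b1 i)
  let χ2 : Fin k₂ → EReal := fun i => erelu (emulVec W2 χ1 i + b2 i)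
  let χ3 : Fin k₃ → EReal := fun i => erelu (emulVec W3 χ2 i + b3 i)
  fun i => emulVec W4 χ3 i + b4 i


noncomputable def mobF {k p : ℕ} {V : Type} [AddCommGroup V] (S : Fin p → Finset (Fin k))
    (F : Fin p → V) (a : Fin p) : V :=
  F a - ∑ j : {j : Fin p // S a ⊂ S j}, mobF S F j.1
termination_by k - (S a).card
decreasing_by
  have h1 := Finset.card_lt_card j.2
  have h2 := Finset.card_le_univ (S j.1)
  simp only [Fintype.card_fin] at h2
  omega

lemma mobF_sum {k p : ℕ} {V : Type} [AddCommGroup V] (S : Fin p → Finset (Fin k))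
    (F : Fin p → V) (a : Fin p) (ha : ∀ b, S b = S a → b = a) :
    ∑ j, (if S a ⊆ S j then mobF S F j else 0) = F a := by
  have h1 : ∀ j, (if S a ⊆ S j then mobF S F j else 0)
      = (if j = a then mobF S F j else 0) + (if S a ⊂ S j then mobF S F j else 0) := by
    intro j
    by_cases hj : j = a
    · subst hj; simp
    · by_cases hs : S a ⊆ S j
      · have : S a ⊂ S j := lt_of_le_of_ne hs (fun h => hj (ha j h.symm))
        simp [hj, hs, this]
      · have : ¬ S a ⊂ S j := fun h => hs h.1
        simp [hj, hs, this]
  rw [Finset.sum_congr rfl (fun j _ => h1 j), Finset.sum_add_distrib]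
  simp only [Finset.sum_ite_eq', Finset.mem_univ, if_true]
  have h2 : ∑ j ∈ Finset.univ.filter (fun j => S a ⊂ S j), mobF S F j
      = ∑ j : {j : Fin p // S a ⊂ S j}, mobF S F j.1 :=
    Finset.sum_subtype _ (by intro j; simp) _
  rw [← Finset.sum_filter, h2, mobF]
  simp

lemma erelu_coe (r : ℝ) : erelu (r : EReal) = ((max 0 r : ℝ) : EReal) := by
  unfold erelu
  rcases le_total 0 r with h | h
  · rw [max_eq_right h, max_eq_right (by exact_mod_cast h)]
  · rw [max_eq_left h, max_eq_left (by exact_mod_cast h)]; rfl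

lemma coe_sum' {ι : Type} (s : Finset ι) (f : ι → ℝ) :
    ((∑ i ∈ s, f i : ℝ) : EReal) = ∑ i ∈ s, (f i : EReal) := by
  classical
  induction s using Finset.induction_on with
  | empty => simp
  | insert a s h ih => simp [Finset.sum_insert h, ih]

lemma emulVec_equiv {a c : ℕ} {I J : Type} [Fintype J] (e : Fin a ≃ I) (e' : Fin c ≃ J)
    (w : I → J → EReal) (v : J → EReal) (i : Fin a) :
    emulVec (fun i j => w (e i) (e' j)) (fun j => v (e' j)) i = ∑ j, w (e i) j * v j :=
  Equiv.sum_comp e' (fun j => w (e i) j * v j)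

def sg (b : Bool) : ℝ := if b then 1 else -1

lemma sg_max (x : ℝ) : ∑ b, sg b * max 0 (sg b * x) = x := by
  simp only [Fintype.sum_bool, sg]
  rcases le_total 0 x with h | h <;> simp [h]

lemma relu_gate (r u : ℝ) (hu : 0 ≤ u) :
    erelu ((r : EReal) + ⊥ * (u : EReal)) = ((if u = 0 then max 0 r else 0 : ℝ) : EReal) := by
  by_cases h : u = 0
  · subst h; simp [erelu_coe]
  · have : 0 < u := lt_of_le_of_ne hu (Ne.symm h)
    rw [EReal.bot_mul_coe_of_pos this]
    simp [h, erelu]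

/-- If `ω_1, …, ω_p` is a partition of `ℝⁿ` where each part `ω_j` is the
intersection of the half-spaces `H_i = {x | ∑ t h i t * x t > c i}` for `i ∈ S j` with the
complements of the remaining half-spaces, and `f` agrees with the affine map
`x ↦ α_j x + β_j` on each `ω_j`, then `f` is computed by a shallow three-hidden-layer
network over the extended reals with hidden widths `2n + k`, `2n + p` and `2·p·m`. -/
theorem pwl_on_halfspace_partition_equals_shallow_network
    (n m k p : ℕ)
    (h : Fin k → Fin n → ℝ) (c : Fin k → ℝ)
    (S : Fin p → Finset (Fin k))
    (ω : Fin p → Set (Fin n → ℝ))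
    (hω : ∀ j, ω j =
      {x | ∀ i : Fin k,
        (i ∈ S j → c i < ∑ t, h i t * x t) ∧ (i ∉ S j → ¬ c i < ∑ t, h i t * x t)})
    (hcover : ∀ x, ∃ j, x ∈ ω j)
    (hdisj : ∀ j j', j ≠ j' → Disjoint (ω j) (ω j'))
    (f : (Fin n → ℝ) → Fin m → ℝ)
    (α : Fin p → Matrix (Fin m) (Fin n) ℝ) (β : Fin p → Fin m → ℝ)
    (hf : ∀ j, ∀ x ∈ ω j, ∀ i, f x i = (α j).mulVec x i + β j i) :
    ∃ (W1 : Matrix (Fin (2 * n + k)) (Fin n) EReal) (b1 : Fin (2 * n + k) → EReal)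
      (W2 : Matrix (Fin (2 * n + p)) (Fin (2 * n + k)) EReal) (b2 : Fin (2 * n + p) → EReal)
      (W3 : Matrix (Fin (2 * p * m)) (Fin (2 * n + p)) EReal) (b3 : Fin (2 * p * m) → EReal)
      (W4 : Matrix (Fin m) (Fin (2 * p * m)) EReal) (b4 : Fin m → EReal),
      ∀ (x : Fin n → ℝ) (i : Fin m),
        shallow n m (2 * n + k) (2 * n + p) (2 * p * m) W1 b1 W2 b2 W3 b3 W4 b4 x i
          = ((f x i : ℝ) : EReal) := by
  classical
  obtain ⟨e1⟩ : Nonempty (Fin (2 * n + k) ≃ (Bool × Fin n) ⊕ Fin k) :=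
    ⟨Fintype.equivOfCardEq (by simp)⟩
  obtain ⟨e2⟩ : Nonempty (Fin (2 * n + p) ≃ (Bool × Fin n) ⊕ Fin p) :=
    ⟨Fintype.equivOfCardEq (by simp)⟩
  obtain ⟨e3⟩ : Nonempty (Fin (2 * p * m) ≃ Bool × Fin p × Fin m) :=
    ⟨Fintype.equivOfCardEq (by simp [mul_assoc])⟩
  let G : Fin p → Matrix (Fin m) (Fin n) ℝ × (Fin m → ℝ) := mobF S (fun j => (α j, β j))
  let w1 : (Bool × Fin n) ⊕ Fin k → Fin n → ℝ := fun s t =>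
    Sum.elim (fun q => if t = q.2 then sg q.1 else 0) (fun i => h i t) s
  let c1 : (Bool × Fin n) ⊕ Fin k → ℝ := Sum.elim (fun _ => 0) (fun i => - c i)
  let w2 : (Bool × Fin n) ⊕ Fin p → (Bool × Fin n) ⊕ Fin k → ℝ := fun s s' =>
    Sum.elim (fun q => Sum.elim (fun q' => if q' = q then 1 else 0) (fun _ => 0) s')
      (fun j => Sum.elim (fun _ => 0) (fun i => if i ∈ S j then 0 else 1) s') s
  let w3 : Bool × Fin p × Fin m → (Bool × Fin n) ⊕ Fin p → EReal := fun q s =>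
    Sum.elim (fun r => ((sg q.1 * ((G q.2.1).1 q.2.2 r.2 * sg r.1) : ℝ) : EReal))
      (fun j => if j = q.2.1 then ⊥ else 0) s
  let c3 : Bool × Fin p × Fin m → ℝ := fun q => sg q.1 * (G q.2.1).2 q.2.2
  let w4 : Fin m → Bool × Fin p × Fin m → ℝ := fun i q => if q.2.2 = i then sg q.1 else 0
  refine ⟨fun i t => (w1 (e1 i) t : EReal), fun i => (c1 (e1 i) : EReal),
    fun i j => (w2 (e2 i) (e1 j) : EReal), fun _ => 0,
    fun i j => w3 (e3 i) (e2 j), fun i => (c3 (e3 i) : EReal),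
    fun i j => (w4 i (e3 j) : EReal), fun _ => 0, ?_⟩
  intro x i
  let v1 : (Bool × Fin n) ⊕ Fin k → ℝ :=
    Sum.elim (fun q => max 0 (sg q.1 * x q.2)) (fun i => max 0 (∑ t, h i t * x t - c i))
  let u : Fin p → ℝ := fun j => ∑ i, (if i ∈ S j then 0 else max 0 (∑ t, h i t * x t - c i))
  let v2 : (Bool × Fin n) ⊕ Fin p → ℝ :=
    Sum.elim (fun q => max 0 (sg q.1 * x q.2)) u
  let gx : Fin p → Fin m → ℝ := fun j i => (G j).1.mulVec x i + (G j).2 i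
  let v3 : Bool × Fin p × Fin m → ℝ := fun q =>
    if u q.2.1 = 0 then max 0 (sg q.1 * gx q.2.1 q.2.2) else 0
  have hu0 : ∀ j, 0 ≤ u j := fun j => Finset.sum_nonneg (fun i _ => by
    split_ifs
    · exact le_rfl
    · exact le_max_left _ _)
  have L1 : (fun a => erelu (emulVec (fun i t => (w1 (e1 i) t : EReal)) (fun j => (x j : EReal)) a
      + (c1 (e1 a) : EReal))) = fun a => ((v1 (e1 a) : ℝ) : EReal) := by
    funext a
    have : emulVec (fun i t => (w1 (e1 i) t : EReal)) (fun j => (x j : EReal)) a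
        = ((∑ t, w1 (e1 a) t * x t : ℝ) : EReal) := by
      rw [coe_sum']; simp [emulVec]
    rw [this, ← EReal.coe_add, erelu_coe]
    congr 1
    rcases e1 a with q | q
    · simp [w1, c1, v1]
    · simp [w1, c1, v1, sub_eq_add_neg]
  have L2 : (fun a => erelu (emulVec (fun i j => (w2 (e2 i) (e1 j) : EReal))
      (fun j => ((v1 (e1 j) : ℝ) : EReal)) a + 0)) = fun a => ((v2 (e2 a) : ℝ) : EReal) := by
    funext a
    have : emulVec (fun i j => (w2 (e2 i) (e1 j) : EReal)) (fun j => ((v1 (e1 j) : ℝ) : EReal)) a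
        = ((∑ s, w2 (e2 a) s * v1 s : ℝ) : EReal) := by
      rw [coe_sum']
      exact (emulVec_equiv e2 e1 (fun s s' => (w2 s s' : EReal)) (fun s => (v1 s : EReal)) a).trans
        (by simp)
    rw [this, add_zero, erelu_coe]
    congr 1
    rcases e2 a with q | q
    · simp [w2, v1, v2]
    · have := hu0 q
      simp only [w2, v1, v2, Fintype.sum_sum_type, Sum.elim_inl, Sum.elim_inr, zero_mul,
        Finset.sum_const_zero, zero_add, ite_mul, one_mul]
      exact max_eq_right this
  have L3 : (fun a => erelu (emulVec (fun i j => w3 (e3 i) (e2 j))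
      (fun j => ((v2 (e2 j) : ℝ) : EReal)) a + (c3 (e3 a) : EReal)))
      = fun a => ((v3 (e3 a) : ℝ) : EReal) := by
    funext a
    rw [emulVec_equiv e3 e2 w3 (fun s => (v2 s : EReal)) a]
    rcases e3 a with ⟨b, j, l⟩
    have h1 : ∑ r : Bool × Fin n, w3 (b, j, l) (Sum.inl r) * (v2 (Sum.inl r) : EReal)
        = ((sg b * (G j).1.mulVec x l : ℝ) : EReal) := by
      have : (sg b * (G j).1.mulVec x l : ℝ) = ∑ r : Bool × Fin n,
          (sg b * ((G j).1 l r.2 * sg r.1)) * max 0 (sg r.1 * x r.2) := by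
        rw [Fintype.sum_prod_type_right, Matrix.mulVec, dotProduct, Finset.mul_sum]
        refine Finset.sum_congr rfl fun t _ => ?_
        conv_lhs => rw [← sg_max (x t)]
        rw [Finset.mul_sum, Finset.mul_sum]
        refine Finset.sum_congr rfl fun b' _ => ?_
        ring
      rw [this, coe_sum']
      refine Finset.sum_congr rfl fun r _ => ?_
      rw [EReal.coe_mul]
      rfl
    have h2 : ∑ j', w3 (b, j, l) (Sum.inr j') * (v2 (Sum.inr j') : EReal) = ⊥ * (u j : EReal) := by
      simp [w3, v2]
    rw [Fintype.sum_sum_type, h1, h2, add_right_comm, ← EReal.coe_add, relu_gate _ _ (hu0 j)]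
    simp only [v3, gx, c3, mul_add]
  have L4 : emulVec (fun i j => (w4 i (e3 j) : EReal)) (fun j => ((v3 (e3 j) : ℝ) : EReal)) i
      = ((∑ q, w4 i q * v3 q : ℝ) : EReal) := by
    rw [coe_sum']
    exact (emulVec_equiv (Equiv.refl _) e3 (fun s s' => (w4 s s' : EReal))
      (fun s => (v3 s : EReal)) i).trans (by simp)
  unfold shallow
  simp only []
  rw [L1, L2, L3, L4, add_zero]
  congr 1
  obtain ⟨a, ha⟩ := hcover x
  have hmem := ha
  rw [hω a] at hmem
  have huniq : ∀ b, S b = S a → b = a := by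
    intro b hb
    by_contra hne
    have : x ∈ ω b := by rw [hω b, hb]; exact hmem
    exact Set.disjoint_left.mp (hdisj b a hne) this ha
  have hu : ∀ j, u j = 0 ↔ S a ⊆ S j := by
    intro j
    rw [Finset.sum_eq_zero_iff_of_nonneg (fun i _ => by
      split_ifs
      · exact le_rfl
      · exact le_max_left _ _)]
    constructor
    · intro H i hi
      by_contra hij
      have h1 := H i (Finset.mem_univ _)
      have h2 := (hmem i).1 hi
      rw [if_neg hij, max_eq_right (by linarith)] at h1
      linarith
    · intro H i _
      split_ifs with hij
      · rfl
      · have := (hmem i).2 (fun hh => hij (H hh))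
        exact max_eq_left (by linarith)
  have key := mobF_sum S (fun j => (α j, β j)) a huniq
  have hsum : ∑ q, w4 i q * v3 q = ∑ j, if S a ⊆ S j then gx j i else 0 := by
    rw [Fintype.sum_prod_type_right, Fintype.sum_prod_type]
    refine Finset.sum_congr rfl fun j _ => ?_
    rw [Finset.sum_eq_single i]
    · by_cases hj : S a ⊆ S j
      · have := (hu j).2 hj
        simp only [w4, v3, this, hj, if_true]
        exact sg_max _
      · have : ¬ u j = 0 := fun h => hj ((hu j).1 h)
        simp [w4, v3, this, hj]
    · intro l _ hl
      simp [w4, hl]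
    · simp
  rw [hsum, hf a x ha i]
  let ev : Matrix (Fin m) (Fin n) ℝ × (Fin m → ℝ) →+ ℝ :=
    { toFun := fun g => g.1.mulVec x i + g.2 i
      map_zero' := by simp
      map_add' := by intro g g'; simp [Matrix.add_mulVec]; ring }
  have := congrArg ev key
  rw [map_sum] at this
  refine Eq.trans (Finset.sum_congr rfl fun j _ => ?_) this
  split_ifs
  · rfl
  · exact (map_zero ev).symm
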